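/- arXiv:1202.0847 — 2 statements merged into one kernel-verified Lean document; each statement's English description precedes it below -/
import Mathlib

section
/- Let G be a 2-connected graph with n vertices and let u, v be two distinct vertices of G. Then the vertices of G can be ordered as u₁ = u, u₂, …, uₙ = v so that for each i = 1, …, n−1, both induced subgraphs G[{u₁,…,uᵢ}] and G[{u_{i+1},…,uₙ}] are connected. -/
open SimpleGraph

/-- A graph is 2-connected: it has at least 3 vertices and removing any single
vertex leaves a connected graph. -/
def TwoConnected {V : Type*} [Fintype V] (G : SimpleGraph V) : Prop :=
  3 ≤ Fintype.card V ∧ ∀ v : V, (G.induce ({v}ᶜ : Set V)).Connected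

lemma conn_of_iff {V : Type*} {G : SimpleGraph V} {S T : Set V}
    (hS : (G.induce S).Connected) (h : ∀ x, x ∈ T ↔ x ∈ S) : (G.induce T).Connected := by
  obtain rfl : T = S := Set.ext h
  exact hS

/-- In a connected induced subgraph there is an edge leaving every proper nonempty part. -/
lemma exists_edge_of_conn {V : Type*} {G : SimpleGraph V} {S T : Set V}
    (hS : (G.induce S).Connected) {a b : V} (ha : a ∈ S) (hb : b ∈ S) (haT : a ∈ T)
    (hbT : b ∉ T) : ∃ x y, x ∈ S ∧ y ∈ S ∧ x ∈ T ∧ y ∉ T ∧ G.Adj x y := by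
  obtain ⟨p⟩ := hS.preconnected ⟨a, ha⟩ ⟨b, hb⟩
  obtain ⟨d, -, h1, h2⟩ := p.exists_boundary_dart {z | (z : V) ∈ T} haT hbT
  exact ⟨d.fst, d.snd, d.fst.2, d.snd.2, h1, h2, d.adj⟩

lemma conn_singleton {V : Type*} (G : SimpleGraph V) (x : V) :
    (G.induce ({x} : Set V)).Connected := by
  have : Nonempty ({x} : Set V) := ⟨⟨x, rfl⟩⟩
  refine ⟨?_⟩
  rintro ⟨a, rfl⟩ ⟨b, hb⟩
  obtain rfl : b = a := hb
  exact Reachable.refl _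

lemma conn_insert {V : Type*} {G : SimpleGraph V} {S : Set V}
    (hS : (G.induce S).Connected) {s x : V} (hs : s ∈ S) (hadj : G.Adj s x) :
    (G.induce (insert x S)).Connected := by
  have := connected_induce_union hS.preconnected (conn_singleton G x).preconnected hs
    (Set.mem_singleton x) hadj
  rwa [Set.union_singleton] at this

/-- Growing step: from a connected part `K` of `Aᶜ` containing `v` and a vertex `x` of
`Aᶜ` outside `K` adjacent to `A`, we reach a vertex that can be moved to `A`. -/
lemma grow {V : Type*} [Fintype V] {G : SimpleGraph V}
    (h2 : ∀ w : V, (G.induce ({w}ᶜ : Set V)).Connected) {v : V} {A : Set V}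
    (hAc : (G.induce Aᶜ).Connected) (n : ℕ) :
    ∀ (K : Set V) (x : V), Kᶜ.ncard = n → K ⊆ Aᶜ → v ∈ K → (G.induce K).Connected →
      x ∉ A → x ∉ K → (∃ a ∈ A, G.Adj a x) →
      ∃ y, y ∉ A ∧ y ≠ v ∧ (∃ a ∈ A, G.Adj a y) ∧ (G.induce (insert y A)ᶜ).Connected := by
  induction n using Nat.strong_induction_on with
  | _ n ih =>
  intro K x hn hKA hvK hK hxA hxK hxa
  have hdec : ∀ c, c ∉ K → (insert c K)ᶜ.ncard < n := by
    intro c hc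
    rw [← hn]
    apply Set.ncard_lt_ncard _ (Set.toFinite _)
    rw [Set.ssubset_iff_of_subset (Set.compl_subset_compl.2 (Set.subset_insert c K))]
    exact ⟨c, hc, by simp⟩
  have hxv : x ≠ v := fun h => hxK (h ▸ hvK)
  by_cases hall : ∀ c, c ∉ A → c ∉ K → c = x
  · refine ⟨x, hxA, hxv, hxa, ?_⟩
    have : (insert x A)ᶜ = K := by
      ext z
      simp only [Set.mem_compl_iff, Set.mem_insert_iff, not_or]
      constructor
      · rintro ⟨h1, h3⟩
        by_contra h4
        exact h1 (hall z h3 h4)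
      · intro hz
        exact ⟨fun h => hxK (h ▸ hz), hKA hz⟩
    rwa [this]
  · push Not at hall
    obtain ⟨c, hcA, hcK, hcx⟩ := hall
    by_cases hKC : ∃ k ∈ K, ∃ d, d ∉ A ∧ d ∉ K ∧ d ≠ x ∧ G.Adj k d
    · obtain ⟨k, hk, d, hdA, hdK, hdx, hkd⟩ := hKC
      refine ih _ (hdec d hdK) (insert d K) x rfl ?_ (Set.mem_insert_of_mem _ hvK)
        (conn_insert hK hk hkd) hxA ?_ hxa
      · exact Set.insert_subset hdA hKA
      · rintro (h | h)
        · exact hdx h.symm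
        · exact hxK h
    · push Not at hKC
      obtain ⟨k, x', -, hx'A, hkK, hx'K, hkx⟩ :=
        exists_edge_of_conn hAc (T := K) (hKA hvK) (show x ∈ Aᶜ from hxA) hvK hxK
      have hx' : x' = x := by
        by_contra h
        exact hKC k hkK x' hx'A hx'K h hkx
      subst hx'
      obtain ⟨y, z, hy, hz, hyT, hzT, hyz⟩ :=
        exists_edge_of_conn (h2 x') (T := {z | z ∉ A ∧ z ∉ K})
          (show c ∈ ({x'}ᶜ : Set V) from hcx) (show v ∈ ({x'}ᶜ : Set V) from hxv.symm)
          ⟨hcA, hcK⟩ (fun h => h.2 hvK)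
      have hzA : z ∈ A := by
        by_contra hzA
        have hzK : z ∈ K := by
          by_contra hzK
          exact hzT ⟨hzA, hzK⟩
        exact hKC z hzK y hyT.1 hyT.2 hy hyz.symm
      refine ih _ (hdec x' hxK) (insert x' K) y rfl (Set.insert_subset hxA hKA)
        (Set.mem_insert_of_mem _ hvK) (conn_insert hK hkK hkx) hyT.1 ?_ ⟨z, hzA, hyz.symm⟩
      rintro (h | h)
      · exact hy h
      · exact hyT.2 h

lemma exists_list {V : Type*} [Fintype V] {G : SimpleGraph V}
    (h2 : ∀ w : V, (G.induce ({w}ᶜ : Set V)).Connected) {v : V} (n : ℕ) :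
    ∀ A : Set V, Aᶜ.ncard = n → A.Nonempty → v ∉ A → (G.induce A).Connected →
      (G.induce Aᶜ).Connected →
      ∃ l : List V, l.Nodup ∧ (∀ x, x ∈ l ↔ x ∉ A) ∧ l.getLast? = some v ∧
        ∀ k < l.length, (G.induce {x | x ∈ A ∨ x ∈ l.take k}).Connected ∧
          (G.induce {x | x ∈ l.drop k}).Connected := by
  induction n using Nat.strong_induction_on with
  | _ n ih =>
  intro A hn hne hvA hA hAc
  by_cases hall : ∀ c, c ∉ A → c = v
  · refine ⟨[v], by simp, ?_, by simp, ?_⟩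
    · intro x
      simp only [List.mem_singleton]
      exact ⟨fun h => h ▸ hvA, hall x⟩
    · intro k hk
      obtain rfl : k = 0 := by simpa using hk
      constructor
      · exact conn_of_iff hA (fun x => by simp)
      · exact conn_of_iff (conn_singleton G v) (fun x => by simp)
  · push Not at hall
    obtain ⟨c, hcA, hcv⟩ := hall
    obtain ⟨a0, ha0⟩ := hne
    obtain ⟨a, x, ha, hx, haA, hxA, hax⟩ :=
      exists_edge_of_conn (h2 v) (T := A)
        (show a0 ∈ ({v}ᶜ : Set V) from fun h => hvA (h ▸ ha0))
        (show c ∈ ({v}ᶜ : Set V) from hcv) ha0 hcA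
    obtain ⟨y, hyA, hyv, ⟨b, hbA, hby⟩, hyc⟩ := grow h2 hAc _ {v} x rfl
      (Set.singleton_subset_iff.2 hvA) rfl (conn_singleton G v) hxA hx ⟨a, haA, hax⟩
    have hlt : (insert y A)ᶜ.ncard < n := by
      rw [← hn]
      apply Set.ncard_lt_ncard _ (Set.toFinite _)
      rw [Set.ssubset_iff_of_subset (Set.compl_subset_compl.2 (Set.subset_insert y A))]
      exact ⟨y, hyA, by simp⟩
    obtain ⟨l, hnd, hmem, hlast, hl⟩ := ih _ hlt (insert y A) rfl ⟨y, by simp⟩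
      (by simp [hvA, hyv.symm]) (conn_insert hA hbA hby) hyc
    refine ⟨y :: l, ?_, ?_, ?_, ?_⟩
    · simp [hnd, hmem]
    · intro z
      simp only [List.mem_cons, hmem, Set.mem_insert_iff]
      by_cases hz : z = y
      · simp [hz, hyA]
      · simp [hz]
    · rw [List.getLast?_cons, hlast]; simp
    · intro k hk
      cases k with
      | zero =>
        constructor
        · exact conn_of_iff hA (fun x => by simp)
        · have : {x | x ∈ (y :: l).drop 0} = Aᶜ := by
            ext z
            simp only [List.drop_zero, List.mem_cons, Set.mem_ofPred_eq, hmem,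
              Set.mem_insert_iff, Set.mem_compl_iff]
            by_cases hz : z = y
            · simp [hz, hyA]
            · simp [hz]
          rwa [this]
      | succ k =>
        obtain ⟨h3, h4⟩ := hl k (by simpa using hk)
        constructor
        · refine conn_of_iff h3 (fun x => ?_)
          simp only [List.take_succ_cons, List.mem_cons, Set.mem_insert_iff, Set.mem_ofPred_eq]
          tauto
        · exact conn_of_iff h4 (fun x => by simp)

theorem stmt1 {V : Type*} [Fintype V] (G : SimpleGraph V)
    (h2 : TwoConnected G) (hcard : 3 ≤ Fintype.card V)
    (u v : V) (huv : u ≠ v) :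
    ∃ e : Fin (Fintype.card V) ≃ V,
      e ⟨0, by omega⟩ = u ∧ e ⟨Fintype.card V - 1, by omega⟩ = v ∧
      ∀ i : Fin (Fintype.card V), (i : ℕ) < Fintype.card V - 1 →
        (G.induce {x : V | ∃ j : Fin (Fintype.card V), j ≤ i ∧ e j = x}).Connected ∧
        (G.induce {x : V | ∃ j : Fin (Fintype.card V), i < j ∧ e j = x}).Connected := by
  classical
  obtain ⟨l, hnd, hmem, hlast, hl⟩ := exists_list h2.2 (v := v) _ {u} rfl ⟨u, rfl⟩
    (fun h => huv h.symm) (conn_singleton G u) (h2.2 u)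
  have hnd' : (u :: l).Nodup := by simp [hnd, hmem]
  have hall : ∀ x, x ∈ u :: l := by
    intro x
    simp only [List.mem_cons, hmem, Set.mem_singleton_iff]
    tauto
  let e0 := hnd'.getEquivOfForallMemList (u :: l) hall
  have hlen : (u :: l).length = Fintype.card V := by
    simpa using Fintype.card_congr e0
  have hlen' : l.length + 1 = Fintype.card V := by simpa using hlen
  let e := (finCongr hlen.symm).trans e0
  have he : ∀ j : Fin (Fintype.card V), e j = (u :: l)[j.1]'(by rw [hlen]; exact j.2) := fun j => rfl
  refine ⟨e, ?_, ?_, ?_⟩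
  · rw [he]; rfl
  · rw [he]
    have h5 : (u :: l).getLast? = some v := by rw [List.getLast?_cons, hlast]; simp
    rw [List.getLast?_eq_getElem?] at h5
    obtain ⟨_, h6⟩ := List.getElem?_eq_some_iff.1 h5
    rw [← h6]
    congr 1
    simp [← hlen']
  · intro i hi
    obtain ⟨h3, h4⟩ := hl i (by omega)
    constructor
    · refine conn_of_iff h3 (fun x => ?_)
      rw [Set.mem_ofPred_eq, Set.mem_ofPred_eq]
      have : (x ∈ ({u} : Set V) ∨ x ∈ l.take i) ↔ x ∈ (u :: l).take (i + 1) := by simp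
      rw [this, List.mem_take_iff_getElem]
      constructor
      · rintro ⟨j, hj, rfl⟩
        have : j.1 ≤ i.1 := hj
        exact ⟨j, by rw [hlen]; omega, (he j).symm⟩
      · rintro ⟨j, hj, rfl⟩
        rw [hlen] at hj
        exact ⟨⟨j, by omega⟩, by rw [Fin.le_def]; simp only; omega, he _⟩
    · refine conn_of_iff h4 (fun x => ?_)
      rw [Set.mem_ofPred_eq, Set.mem_ofPred_eq]
      have : x ∈ l.drop i ↔ x ∈ (u :: l).drop (i + 1) := by simp
      rw [this, List.mem_drop_iff_getElem]
      constructor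
      · rintro ⟨j, hj, rfl⟩
        have hj' : i.1 < j.1 := hj
        refine ⟨j - (i + 1), by rw [hlen]; omega, ?_⟩
        rw [he]
        congr 1
        omega
      · rintro ⟨j, hj, rfl⟩
        rw [hlen] at hj
        exact ⟨⟨i + 1 + j, by omega⟩, by rw [Fin.lt_def]; simp only; omega, he _⟩
end

section
/- If v is a cut vertex of a connected graph G such that G − v has at least three connected components, then there is no ordering v₁, v₂, …, vₙ of all vertices of G such that for every i with 1 ≤ i ≤ n−1, both the induced subgraph on {v₁,…,vᵢ} and the induced subgraph on {v_{i+1},…,vₙ} are connected. -/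
open SimpleGraph

theorem stmt2 {V : Type*} [Fintype V] (G : SimpleGraph V) (hG : G.Connected)
    (v : V)
    (hcut : 3 ≤ Nat.card ((G.induce ({v}ᶜ : Set V)).ConnectedComponent)) :
    ¬ ∃ e : Fin (Fintype.card V) ≃ V,
        ∀ i : Fin (Fintype.card V), (i : ℕ) < Fintype.card V - 1 →
          (G.induce {x : V | ∃ j : Fin (Fintype.card V), j ≤ i ∧ e j = x}).Connected ∧
          (G.induce {x : V | ∃ j : Fin (Fintype.card V), i < j ∧ e j = x}).Connected := by
  rintro ⟨e, he⟩
  have key : ∀ (S : Set V), (G.induce S).Connected → S ⊆ ({v}ᶜ : Set V) →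
      ∀ x y : ({v}ᶜ : Set V), x.1 ∈ S → y.1 ∈ S →
        (G.induce ({v}ᶜ : Set V)).Reachable x y := by
    intro S hS hsub x y hx hy
    exact (hS.preconnected ⟨x.1, hx⟩ ⟨y.1, hy⟩).map (SimpleGraph.induceHomOfLE G hsub).toHom
  obtain ⟨k, rfl⟩ := e.surjective v
  have hne : ∀ x : ({e k}ᶜ : Set V), e.symm x.1 ≠ k := by
    intro x h
    exact x.2 (by simp [← h])
  have hlt : ∀ x y : ({e k}ᶜ : Set V), e.symm x.1 < k → e.symm y.1 < k →
      (G.induce ({e k}ᶜ : Set V)).Reachable x y := by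
    intro x y hx hy
    have hk := k.2
    have hx' : (e.symm x.1 : ℕ) < k := hx
    have hy' : (e.symm y.1 : ℕ) < k := hy
    refine key _ (he ⟨k - 1, by omega⟩ (by simp only; omega)).1 ?_ x y
      ⟨e.symm x.1, ?_, by simp⟩ ⟨e.symm y.1, ?_, by simp⟩
    · rintro _ ⟨j, hj, rfl⟩ h
      have : j = k := e.injective h
      subst this
      have : (j : ℕ) ≤ j - 1 := hj
      omega
    · change (e.symm x.1 : ℕ) ≤ k - 1
      omega
    · change (e.symm y.1 : ℕ) ≤ k - 1
      omega
  have hgt : ∀ x y : ({e k}ᶜ : Set V), k < e.symm x.1 → k < e.symm y.1 →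
      (G.induce ({e k}ᶜ : Set V)).Reachable x y := by
    intro x y hx hy
    have hx' : (k : ℕ) < (e.symm x.1 : ℕ) := hx
    have hx2 := (e.symm x.1).2
    refine key _ (he k (by omega)).2 ?_ x y
      ⟨e.symm x.1, hx, by simp⟩ ⟨e.symm y.1, hy, by simp⟩
    rintro _ ⟨j, hj, rfl⟩ h
    have : j = k := e.injective h
    exact absurd this hj.ne'
  have hinj : Function.Injective
      (fun c : (G.induce ({e k}ᶜ : Set V)).ConnectedComponent =>
        decide (e.symm (Quot.out c).1 < k)) := by
    intro c d h
    have hr : (G.induce ({e k}ᶜ : Set V)).Reachable (Quot.out c) (Quot.out d) := by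
      have h' := decide_eq_decide.mp h
      by_cases hc : e.symm (Quot.out c).1 < k
      · exact hlt _ _ hc (h'.mp hc)
      · have hd := fun hd => hc (h'.mpr hd)
        exact hgt _ _ (lt_of_le_of_ne (not_lt.mp hc) (hne _).symm)
          (lt_of_le_of_ne (not_lt.mp hd) (hne _).symm)
    have := Quot.sound (r := (G.induce ({e k}ᶜ : Set V)).Reachable) hr
    rw [← Quot.out_eq c, ← Quot.out_eq d]
    exact this
  have := Nat.card_le_card_of_injective _ hinj
  have h2 : Nat.card Bool = 2 := by simp
  omega
end
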